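/- Let Ext: 𝔽₂^d × 𝔽₂^n → 𝔽₂^ℓ be a linear strong seeded (n−t, ε/8)-extractor such that Ext(z,·) is surjective for every seed z, and let (Enc, Dec) be a stochastic affine erasure-correcting code with encoder Enc: 𝔽₂^{d+n} × R → 𝔽₂^N that tolerates N−r erasures with failure probability at most δ. Define Share(s) = Enc(Z‖X, ρ) where (Z,X) is uniform on {(z,x) : Ext(z,x) = s} and ρ is uniform on R, independent; define Recst(ṽ) = Ext(z,x) where (z‖x) = Dec(ṽ). Then: (privacy) for every pair of secrets s₀, s₁ ∈ 𝔽₂^ℓ and every subset A ⊆ [N] with |A| ≤ t, SD(Share(s₀)_A; Share(s₁)_A) ≤ ε; and (reconstruction) for every secret s and every erasure pattern erasing at most N−r coordinates of Share(s), Recst outputs s with probability at least 1−δ. -/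

import Mathlib

/-- The probability, over a uniformly random sample `ω : Ω`, that `X ω = a`. -/
noncomputable def prob {Ω α : Type*} (X : Ω → α) (a : α) : ℝ :=
  (Nat.card {ω : Ω // X ω = a} : ℝ) / (Nat.card Ω : ℝ)

/-- Statistical distance between the distributions of `X` and `Y` (coins uniform). -/
noncomputable def SD {Ω₁ Ω₂ α : Type*} [Fintype α] (X : Ω₁ → α) (Y : Ω₂ → α) : ℝ :=
  (1 / 2 : ℝ) * ∑ a : α, |prob X a - prob Y a|

/-- `Ext` is a strong seeded `(k,ε)`-extractor. -/
def IsStrongSeededExtractor {d n m : ℕ}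
    (Ext : (Fin d → ZMod 2) → (Fin n → ZMod 2) → (Fin m → ZMod 2)) (k : ℕ) (ε : ℝ) : Prop :=
  ∀ (Ω : Type) [Fintype Ω] [Nonempty Ω], ∀ X : Ω → (Fin n → ZMod 2),
    (∀ x, prob X x ≤ ((2 : ℝ) ^ k)⁻¹) →
    SD (fun p : (Fin d → ZMod 2) × Ω => (p.1, Ext p.1 (X p.2)))
       (id : (Fin d → ZMod 2) × (Fin m → ZMod 2) → (Fin d → ZMod 2) × (Fin m → ZMod 2)) ≤ ε

theorem prob_comp_equiv {Ω Ω' α : Type*} (e : Ω' ≃ Ω) (X : Ω → α) (a : α) :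
    prob (fun ω => X (e ω)) a = prob X a := by
  unfold prob
  rw [Nat.card_congr e, Nat.card_congr (e.subtypeEquiv (q := fun ω => X ω = a) fun _ => Iff.rfl)]

theorem prob_nonneg {Ω α : Type*} (X : Ω → α) (a : α) : 0 ≤ prob X a := by
  unfold prob
  positivity

theorem sum_prob_le_one {Ω α : Type*} [Finite Ω] [Fintype α] (X : Ω → α) :
    ∑ a, prob X a ≤ 1 := by
  unfold prob
  rw [← Finset.sum_div, ← Nat.cast_sum, ← Nat.card_sigma,
    Nat.card_congr (Equiv.sigmaFiberEquiv X)]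
  exact div_self_le_one _

theorem prob_le_prob_map {Ω α β : Type*} [Finite Ω] (X : Ω → α) (g : α → β) (a : α) :
    prob X a ≤ prob (fun ω => g (X ω)) (g a) := by
  unfold prob
  gcongr
  exact Nat.card_le_card_of_injective
    (fun ω : {ω // X ω = a} => (⟨ω.1, congrArg g ω.2⟩ : {ω // g (X ω) = g a}))
    fun _ _ h => Subtype.ext (congrArg (fun ω => ω.1) h)

/-- A variable on a disjoint union of equally large spaces is a uniform mixture. -/
theorem prob_sigma {I α : Type*} {F : I → Type*} [Fintype I] [∀ i, Finite (F i)] {K : ℕ}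
    (hF : ∀ i, Nat.card (F i) = K) (X : (Σ i, F i) → α) (a : α) :
    prob X a = (∑ i, prob (fun ω : F i => X ⟨i, ω⟩) a) / Nat.card I := by
  unfold prob
  have e : {ω // X ω = a} ≃ Σ i, {ω : F i // X ⟨i, ω⟩ = a} :=
    { toFun ω := ⟨ω.1.1, ω.1.2, ω.2⟩
      invFun ω := ⟨⟨ω.1, ω.2.1⟩, ω.2.2⟩
      left_inv _ := rfl
      right_inv _ := rfl }
  simp only [hF]
  rw [Nat.card_congr e, Nat.card_sigma, Nat.card_sigma, ← Finset.sum_div]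
  simp [hF, div_div, mul_comm]

theorem prob_prod {I Ω α : Type*} [Fintype I] [Finite Ω] (X : I × Ω → α) (a : α) :
    prob X a = (∑ i, prob (fun ω => X (i, ω)) a) / Nat.card I := by
  rw [← prob_comp_equiv (Equiv.sigmaEquivProd I Ω) X]
  exact prob_sigma (fun _ => rfl) _ a

theorem SD_le_one {Ω₁ Ω₂ α : Type*} [Fintype α] [Finite Ω₁] [Finite Ω₂]
    (X : Ω₁ → α) (Y : Ω₂ → α) : SD X Y ≤ 1 := by
  have h : ∑ a, |prob X a - prob Y a| ≤ ∑ a, (prob X a + prob Y a) := by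
    refine Finset.sum_le_sum fun a _ => ?_
    have := prob_nonneg X a
    have := prob_nonneg Y a
    rw [abs_le]
    constructor <;> linarith
  rw [Finset.sum_add_distrib] at h
  have := sum_prob_le_one X
  have := sum_prob_le_one Y
  unfold SD
  linarith

theorem SD_eq_zero_of_equiv {Ω₁ Ω₂ α : Type*} [Fintype α] (X : Ω₁ → α) (Y : Ω₂ → α)
    (e : Ω₁ ≃ Ω₂) (h : ∀ ω, Y (e ω) = X ω) : SD X Y = 0 := by
  have : X = fun ω => Y (e ω) := funext fun ω => (h ω).symm
  simp [SD, this, prob_comp_equiv]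

theorem SD_comp_equiv {Ω₁ Ω₂ Ω₁' Ω₂' α : Type*} [Fintype α] (e₁ : Ω₁' ≃ Ω₁) (e₂ : Ω₂' ≃ Ω₂)
    (X : Ω₁ → α) (Y : Ω₂ → α) : SD (fun ω => X (e₁ ω)) (fun ω => Y (e₂ ω)) = SD X Y := by
  simp [SD, prob_comp_equiv]

/-- Joint convexity of the statistical distance under uniform mixtures. -/
theorem SD_sigma_le {I α : Type*} {F G : I → Type*} [Fintype I] [Fintype α]
    [∀ i, Finite (F i)] [∀ i, Finite (G i)] {K K' : ℕ}
    (hF : ∀ i, Nat.card (F i) = K) (hG : ∀ i, Nat.card (G i) = K')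
    (X : (Σ i, F i) → α) (Y : (Σ i, G i) → α) :
    SD X Y ≤ (∑ i, SD (fun ω : F i => X ⟨i, ω⟩) (fun ω : G i => Y ⟨i, ω⟩)) / Nat.card I := by
  unfold SD
  rw [← Finset.mul_sum, mul_div_assoc, Finset.sum_comm, Finset.sum_div]
  gcongr with a
  rw [prob_sigma hF, prob_sigma hG, ← sub_div, ← Finset.sum_sub_distrib, abs_div, Nat.abs_cast]
  gcongr
  exact Finset.abs_sum_le_sum_abs _ _

theorem two_mul_card_le_of_ne_top {m : ℕ} (V : Submodule (ZMod 2) (Fin m → ZMod 2))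
    (hV : V ≠ ⊤) : 2 * Nat.card V ≤ 2 ^ m := by
  have h := Submodule.finrank_lt hV
  rw [Module.finrank_fin_fun] at h
  rw [Module.natCard_eq_pow_finrank (K := ZMod 2), Nat.card_zmod, ← pow_succ']
  exact Nat.pow_le_pow_right two_pos h

theorem prob_id {α : Type*} (a : α) : prob (id : α → α) a = 1 / Nat.card α := by
  simp [prob]

/-- A linear strong extractor maps a large enough linear subspace onto everything, for all but
a small fraction of the seeds. -/
theorem card_not_map_eq_top_le {d n m k : ℕ} {ε : ℝ}
    (Ext : (Fin d → ZMod 2) → (Fin n → ZMod 2) →ₗ[ZMod 2] (Fin m → ZMod 2))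
    (hext : IsStrongSeededExtractor (fun z x => Ext z x) k ε)
    (V : Submodule (ZMod 2) (Fin n → ZMod 2)) (hV : 2 ^ k ≤ Nat.card V) :
    (Nat.card {z // V.map (Ext z) ≠ ⊤} : ℝ) / Nat.card (Fin d → ZMod 2) ≤ 4 * ε := by
  classical
  have hsrc : ∀ x, prob (Subtype.val : V → (Fin n → ZMod 2)) x ≤ ((2 : ℝ) ^ k)⁻¹ := by
    intro x
    unfold prob
    have h1 : Nat.card {v : V // v.1 = x} ≤ 1 := by
      rw [Finite.card_le_one_iff_subsingleton]
      exact ⟨fun a b => Subtype.ext (Subtype.ext (a.2.trans b.2.symm))⟩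
    rw [← one_div]
    gcongr
    · exact_mod_cast h1
    · exact_mod_cast hV
  have hSD := hext V Subtype.val hsrc
  unfold SD at hSD
  rw [Fintype.sum_prod_type] at hSD
  have hz : ∀ z, V.map (Ext z) ≠ ⊤ → 1 / 2 / (Nat.card (Fin d → ZMod 2) : ℝ) ≤
      ∑ y, |prob (fun p : (Fin d → ZMod 2) × V => (p.1, Ext p.1 p.2)) (z, y) -
        prob (id : (Fin d → ZMod 2) × (Fin m → ZMod 2) → _) (z, y)| := by
    intro z hz
    set W := V.map (Ext z)
    have hout : ∀ y, y ∉ W →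
        prob (fun p : (Fin d → ZMod 2) × V => (p.1, Ext p.1 p.2)) (z, y) = 0 := by
      intro y hy
      have : IsEmpty {p : (Fin d → ZMod 2) × V // (p.1, Ext p.1 p.2) = (z, y)} := by
        refine ⟨fun ⟨⟨z', v⟩, h⟩ => hy ?_⟩
        obtain ⟨rfl, rfl⟩ := Prod.mk.inj h
        exact Submodule.mem_map_of_mem v.2
      rw [prob, Nat.card_of_isEmpty, Nat.cast_zero, zero_div]
    have hcard : (2 : ℝ) ^ m / 2 ≤ (Finset.univ.filter (· ∉ W)).card := by
      have h1 := two_mul_card_le_of_ne_top W hz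
      have h2 := Finset.card_filter_add_card_filter_not (s := Finset.univ) (· ∈ W)
      have h3 : Nat.card W = (Finset.univ.filter (· ∈ W)).card := by
        rw [Nat.card_eq_fintype_card, Fintype.card_subtype]
      simp only [Finset.card_univ, Fintype.card_fun, ZMod.card, Fintype.card_fin] at h2
      have h4 : 2 ^ m ≤ 2 * (Finset.univ.filter (· ∉ W)).card := by omega
      have h5 : (2 : ℝ) ^ m ≤ 2 * (Finset.univ.filter (· ∉ W)).card := by exact_mod_cast h4
      linarith
    calc 1 / 2 / (Nat.card (Fin d → ZMod 2) : ℝ)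
        = 2 ^ m / 2 * (1 / Nat.card ((Fin d → ZMod 2) × (Fin m → ZMod 2))) := by
          simp
          field_simp
      _ ≤ (Finset.univ.filter (· ∉ W)).card *
            (1 / Nat.card ((Fin d → ZMod 2) × (Fin m → ZMod 2)) : ℝ) := by gcongr
      _ = ∑ y ∈ Finset.univ.filter (· ∉ W),
            |prob (fun p : (Fin d → ZMod 2) × V => (p.1, Ext p.1 p.2)) (z, y) -
              prob (id : (Fin d → ZMod 2) × (Fin m → ZMod 2) → _) (z, y)| := by
          rw [← nsmul_eq_mul, ← Finset.sum_const]
          refine Finset.sum_congr rfl fun y hy => ?_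
          rw [hout y (Finset.mem_filter.mp hy).2, prob_id, zero_sub, abs_neg,
            abs_of_nonneg (by positivity)]
      _ ≤ _ := Finset.sum_le_sum_of_subset_of_nonneg (Finset.filter_subset _ _)
          fun _ _ _ => abs_nonneg _
  have hsum : (Nat.card {z // V.map (Ext z) ≠ ⊤} : ℝ) *
      (1 / 2 / (Nat.card (Fin d → ZMod 2) : ℝ)) ≤
      ∑ z, ∑ y, |prob (fun p : (Fin d → ZMod 2) × V => (p.1, Ext p.1 p.2)) (z, y) -
        prob (id : (Fin d → ZMod 2) × (Fin m → ZMod 2) → _) (z, y)| := by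
    rw [Nat.card_eq_fintype_card, Fintype.card_subtype, ← nsmul_eq_mul, ← Finset.sum_const]
    refine (Finset.sum_le_sum fun z hz' => hz z (Finset.mem_filter.mp hz').2).trans ?_
    exact Finset.sum_le_sum_of_subset_of_nonneg (Finset.filter_subset _ _)
      fun _ _ _ => Finset.sum_nonneg fun _ _ => abs_nonneg _
  have hrw : (Nat.card {z // V.map (Ext z) ≠ ⊤} : ℝ) *
      (1 / 2 / (Nat.card (Fin d → ZMod 2) : ℝ)) =
      (Nat.card {z // V.map (Ext z) ≠ ⊤} : ℝ) / Nat.card (Fin d → ZMod 2) / 2 := by ring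
  linarith

theorem two_pow_le_card_ker {n t : ℕ} {ι : Type*} [Fintype ι] (hι : Fintype.card ι ≤ t)
    (B : (Fin n → ZMod 2) →ₗ[ZMod 2] (ι → ZMod 2)) :
    2 ^ (n - t) ≤ Nat.card (LinearMap.ker B) := by
  have h1 := B.finrank_range_add_finrank_ker
  have h2 := Submodule.finrank_le (LinearMap.range B)
  rw [Module.finrank_fin_fun] at h1
  rw [Module.finrank_fintype_fun_eq_card] at h2
  rw [Module.natCard_eq_pow_finrank (K := ZMod 2), Nat.card_zmod]
  exact Nat.pow_le_pow_right two_pos (by omega)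

/-- Translation by `v` between two fibers of a linear map. -/
def fiberTranslate {n m : ℕ} (f : (Fin n → ZMod 2) →ₗ[ZMod 2] (Fin m → ZMod 2))
    (s₀ s₁ : Fin m → ZMod 2) (v : Fin n → ZMod 2) (hv : f v = s₁ - s₀) :
    {x // f x = s₀} ≃ {x // f x = s₁} :=
  (Equiv.addRight v).subtypeEquiv fun x => by
    simp only [Equiv.coe_addRight, map_add, hv]
    rw [← eq_sub_iff_add_eq, sub_sub_cancel]

theorem card_fiber {n m : ℕ} (f : (Fin n → ZMod 2) →ₗ[ZMod 2] (Fin m → ZMod 2))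
    (hf : Function.Surjective f) (s : Fin m → ZMod 2) :
    Nat.card {x // f x = s} = 2 ^ (n - m) := by
  obtain ⟨v, hv⟩ := hf (s - 0)
  rw [← Nat.card_congr (fiberTranslate f 0 s v hv)]
  change Nat.card (LinearMap.ker f) = _
  have h1 := f.finrank_range_add_finrank_ker
  rw [LinearMap.range_eq_top.mpr hf, finrank_top, Module.finrank_fin_fun,
    Module.finrank_fin_fun] at h1
  rw [Module.natCard_eq_pow_finrank (K := ZMod 2), Nat.card_zmod,
    Nat.eq_sub_of_add_eq' h1]

/-- Padding with zeros on the left, `x ↦ 0 ‖ x`, as a linear map. -/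
def appendZero (d n : ℕ) : (Fin n → ZMod 2) →ₗ[ZMod 2] (Fin (d + n) → ZMod 2) where
  toFun x := Fin.append 0 x
  map_add' x y := by
    ext i
    refine Fin.addCases (fun i => ?_) (fun i => ?_) i <;> simp
  map_smul' c x := by
    ext i
    refine Fin.addCases (fun i => ?_) (fun i => ?_) i <;> simp

theorem append_add_right {d n : ℕ} (z : Fin d → ZMod 2) (x v : Fin n → ZMod 2) :
    Fin.append z (x + v) = Fin.append z x + appendZero d n v := by
  ext i
  refine Fin.addCases (fun i => ?_) (fun i => ?_) i <;> simp [appendZero]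

/-- Group the pairs `(z, x)` in a fiber, together with coins, by coins and seed. -/
def fiberProdEquiv {S X T R : Type*} (E : S → X → T) (s : T) :
    (Σ i : R × S, {x // E i.2 x = s}) ≃ {p : S × X // E p.1 p.2 = s} × R where
  toFun ω := (⟨(ω.1.2, ω.2.1), ω.2.2⟩, ω.1.1)
  invFun ω := ⟨(ω.2, ω.1.1.1), ⟨ω.1.1.2, ω.1.2⟩⟩
  left_inv _ := rfl
  right_inv _ := rfl

/-- the non-adaptive secret sharing scheme
`Share(s) = Enc(Z‖X, ρ)` with `(Z,X)` uniform on `{(z,x) : Ext(z,x) = s}`, built from a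
linear strong seeded `(n-t, ε/8)`-extractor (surjective for each seed) and a stochastic
affine erasure-correcting code tolerating `N-r` erasures with failure probability `δ`,
satisfies `t`-privacy with error `ε` and reconstruction from any `r` shares with
probability `1-δ` (where `Recst = Ext(z,x)` for `(z‖x) = Dec(ṽ)`). -/
theorem stmt_5 (d n t r N ℓ : ℕ) (ε δ : ℝ) (htn : t ≤ n) (hrN : r ≤ N)
    (Ext : (Fin d → ZMod 2) → (Fin n → ZMod 2) → (Fin ℓ → ZMod 2))
    (hlin : ∀ z, IsLinearMap (ZMod 2) (Ext z))
    (hext : IsStrongSeededExtractor Ext (n - t) (ε / 8))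
    (hsurj : ∀ z, Function.Surjective (Ext z))
    (R : Type) [Fintype R] [Nonempty R]
    (Enc : (Fin (d + n) → ZMod 2) → R → Fin N → ZMod 2)
    (Dec : (Fin N → Option (ZMod 2)) → Option (Fin (d + n) → ZMod 2))
    (hEncAffine : ∀ rc : R, ∃ (L : (Fin (d + n) → ZMod 2) →ₗ[ZMod 2] (Fin N → ZMod 2))
        (Δ : Fin N → ZMod 2), ∀ x, Enc x rc = L x + Δ)
    (hECC : ∀ (x : Fin (d + n) → ZMod 2) (E : Finset (Fin N)), E.card ≤ N - r →
      1 - δ ≤ prob (fun rc : R =>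
        Dec (fun i => if i ∈ E then none else some (Enc x rc i))) (some x)) :
    -- privacy: any `t` shares of `Share(s₀)` and `Share(s₁)` are `ε`-close
    (∀ (s₀ s₁ : Fin ℓ → ZMod 2) (A : Finset (Fin N)), A.card ≤ t →
      SD (fun ω : {p : (Fin d → ZMod 2) × (Fin n → ZMod 2) // Ext p.1 p.2 = s₀} × R =>
            fun i : A => Enc (Fin.append ω.1.1.1 ω.1.1.2) ω.2 i.1)
         (fun ω : {p : (Fin d → ZMod 2) × (Fin n → ZMod 2) // Ext p.1 p.2 = s₁} × R =>
            fun i : A => Enc (Fin.append ω.1.1.1 ω.1.1.2) ω.2 i.1) ≤ ε) ∧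
    -- reconstruction: erasing at most `N - r` coordinates, `Recst` returns `s` w.p. `≥ 1-δ`
    (∀ (s : Fin ℓ → ZMod 2) (E : Finset (Fin N)), E.card ≤ N - r →
      1 - δ ≤ prob (fun ω : {p : (Fin d → ZMod 2) × (Fin n → ZMod 2) // Ext p.1 p.2 = s} × R =>
        (Dec (fun i => if i ∈ E then none else
            some (Enc (Fin.append ω.1.1.1 ω.1.1.2) ω.2 i))).map
          (fun y => Ext (fun a => y (Fin.castAdd n a)) (fun b => y (Fin.natAdd d b))))
        (some s)) := by
  classical
  let f : (Fin d → ZMod 2) → (Fin n → ZMod 2) →ₗ[ZMod 2] (Fin ℓ → ZMod 2) :=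
    fun z => (hlin z).mk' (Ext z)
  have hfib : ∀ s (i : R × (Fin d → ZMod 2)), Nat.card {x // Ext i.2 x = s} = 2 ^ (n - ℓ) :=
    fun s i => card_fiber (f i.2) (hsurj i.2) s
  refine ⟨fun s₀ s₁ A hA => ?_, fun s E hE => ?_⟩
  · choose L Δ hL using hEncAffine
    let B : R → (Fin n → ZMod 2) →ₗ[ZMod 2] (A → ZMod 2) := fun rc =>
      LinearMap.funLeft (ZMod 2) (ZMod 2) (fun i : A => i.1) ∘ₗ L rc ∘ₗ appendZero d n
    have hbad : ∀ rc, (Nat.card {z // (LinearMap.ker (B rc)).map (f z) ≠ ⊤} : ℝ) /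
        Nat.card (Fin d → ZMod 2) ≤ 4 * (ε / 8) := fun rc =>
      card_not_map_eq_top_le f hext _ (two_pow_le_card_ker (by simpa using hA) (B rc))
    rw [← SD_comp_equiv (fiberProdEquiv Ext s₀) (fiberProdEquiv Ext s₁)]
    refine (SD_sigma_le (hfib s₀) (hfib s₁) _ _).trans ?_
    have hseed : ∀ i : R × (Fin d → ZMod 2),
        SD (fun x : {x // Ext i.2 x = s₀} => fun a : A => Enc (Fin.append i.2 x.1) i.1 a.1)
          (fun x : {x // Ext i.2 x = s₁} => fun a : A => Enc (Fin.append i.2 x.1) i.1 a.1) ≤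
        if (LinearMap.ker (B i.1)).map (f i.2) ≠ ⊤ then 1 else 0 := by
      rintro ⟨rc, z⟩
      split_ifs with h
      · exact SD_le_one _ _
      · rw [not_not] at h
        obtain ⟨v, hvB, hv⟩ := (h ▸ Submodule.mem_top :
          s₁ - s₀ ∈ (LinearMap.ker (B rc)).map (f z))
        refine (SD_eq_zero_of_equiv _ _ (fiberTranslate (f z) s₀ s₁ v hv) fun x => ?_).le
        funext a
        have hva : L rc (appendZero d n v) a.1 = 0 := congrFun hvB a
        change Enc (Fin.append z (x.1 + v)) rc a.1 = _
        simp [append_add_right, hL, hva]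
    have havg : (∑ i : R × (Fin d → ZMod 2),
        if (LinearMap.ker (B i.1)).map (f i.2) ≠ ⊤ then (1 : ℝ) else 0) /
          Nat.card (R × (Fin d → ZMod 2)) ≤ ε / 2 := by
      rw [Fintype.sum_prod_type, Nat.card_prod, Nat.cast_mul, mul_comm, ← div_div,
        Finset.sum_div, div_le_iff₀ (by exact_mod_cast Nat.card_pos)]
      calc _ ≤ ∑ _rc : R, ε / 2 := by
            refine Finset.sum_le_sum fun rc _ => ?_
            rw [Finset.sum_boole, ← Fintype.card_subtype, ← Nat.card_eq_fintype_card]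
            linarith [hbad rc]
        _ = ε / 2 * Nat.card R := by simp [mul_comm]
    have hε : 0 ≤ ε := by
      obtain ⟨rc⟩ := ‹Nonempty R›
      have : 0 ≤ 4 * (ε / 8) := le_trans (by positivity) (hbad rc)
      linarith
    refine (div_le_div_of_nonneg_right (Finset.sum_le_sum fun i _ => hseed i)
      (Nat.cast_nonneg _)).trans (havg.trans (by linarith))
  · obtain ⟨x₀, hx₀⟩ := hsurj 0 s
    have : Nonempty {p : (Fin d → ZMod 2) × (Fin n → ZMod 2) // Ext p.1 p.2 = s} :=
      ⟨⟨(0, x₀), hx₀⟩⟩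
    rw [prob_prod, le_div_iff₀ (by exact_mod_cast Nat.card_pos)]
    calc (1 - δ) * _ = ∑ _p : {p : (Fin d → ZMod 2) × (Fin n → ZMod 2) // Ext p.1 p.2 = s},
          (1 - δ) := by
          rw [Finset.sum_const, Finset.card_univ, nsmul_eq_mul, Nat.card_eq_fintype_card, mul_comm]
      _ ≤ _ := by
        refine Finset.sum_le_sum fun p _ => (hECC (Fin.append p.1.1 p.1.2) E hE).trans ?_
        refine (prob_le_prob_map _ (Option.map fun y : Fin (d + n) → ZMod 2 =>
          Ext (fun a => y (Fin.castAdd n a)) (fun b => y (Fin.natAdd d b))) _).trans_eq ?_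
        simp [p.2]
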